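/- Parallel composition commutes with semantics up to adversarial pruning: let A^1 and A^2 be TIOAs with Act_o^1 ∩ Act_o^2 = ∅ and disjoint clock sets. Identifying states via the canonical bijection ((l^1,l^2), v) ↔ ((l^1, v|_{Clk^1}), (l^2, v|_{Clk^2})), the adversarially pruned TIOTSs (⟦A^1 ∥ A^2⟧)^Δ and (⟦A^1⟧ ∥ ⟦A^2⟧)^Δ are equal: they have the same set of states, the same initial state, the same action sets with the same input/output partition, and the same transition relation. -/

import Mathlib

open scoped NNReal

/-- A (raw) Timed I/O Transition System over an ambient action type `Act`
and state type `Q`.  The actual sets of input and output actions are the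
fields `inputs` and `outputs`; `actTrans` is the action-labelled part of
the transition relation and `delayTrans` the delay-labelled part. -/
structure TIOTS (Act : Type) (Q : Type) where
  init : Q
  inputs : Set Act
  outputs : Set Act
  actTrans : Q → Act → Q → Prop
  delayTrans : Q → ℝ≥0 → Q → Prop

namespace TIOTS

variable {Act Q Q1 Q2 Q3 : Type}

/-- The alphabet (action set) of a TIOTS. -/
def acts (S : TIOTS Act Q) : Set Act := S.inputs ∪ S.outputs

/-- The axioms of Timed I/O Transition Systems: inputs and outputs are
disjoint, action transitions are labelled by actions of the alphabet,
determinism (for actions and delays), time reflexivity and time additivity. -/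
def IsTIOTS (S : TIOTS Act Q) : Prop :=
  Disjoint S.inputs S.outputs ∧
  (∀ q a q', S.actTrans q a q' → a ∈ S.acts) ∧
  (∀ q a q' q'', S.actTrans q a q' → S.actTrans q a q'' → q' = q'') ∧
  (∀ q (d : ℝ≥0) q' q'', S.delayTrans q d q' → S.delayTrans q d q'' → q' = q'') ∧
  (∀ q, S.delayTrans q 0 q) ∧
  (∀ q q'' (d₁ d₂ : ℝ≥0),
    S.delayTrans q (d₁ + d₂) q'' ↔ ∃ q', S.delayTrans q d₁ q' ∧ S.delayTrans q' d₂ q'')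

/-- Input-enabledness: every state accepts every input of the alphabet. -/
def InputEnabled (S : TIOTS Act Q) : Prop :=
  ∀ q, ∀ a ∈ S.inputs, ∃ q', S.actTrans q a q'

/-- A specification is an input-enabled TIOTS. -/
def IsSpecification (S : TIOTS Act Q) : Prop :=
  S.IsTIOTS ∧ S.InputEnabled

/-- A state allows independent progress if it can delay forever, or can
delay until an output is enabled. -/
def IndependentProgress (S : TIOTS Act Q) (q : Q) : Prop :=
  (∀ d : ℝ≥0, ∃ q', S.delayTrans q d q') ∨
  (∃ (d : ℝ≥0) (q' : Q), ∃ o ∈ S.outputs,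
    S.delayTrans q d q' ∧ ∃ q'', S.actTrans q' o q'')

/-- Output urgency of a state: if an output is enabled, no positive delay is. -/
def OutputUrgent (S : TIOTS Act Q) (q : Q) : Prop :=
  ∀ o ∈ S.outputs, ∀ (q' : Q) (d : ℝ≥0) (q'' : Q),
    S.actTrans q o q' → S.delayTrans q d q'' → d = 0

/-- An implementation is a specification all of whose states are
output urgent and allow independent progress. -/
def IsImplementation (P : TIOTS Act Q) : Prop :=
  P.IsSpecification ∧ ∀ q, P.OutputUrgent q ∧ P.IndependentProgress q

/-- A locally consistent specification: every state allows independent progress. -/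
def LocallyConsistent (S : TIOTS Act Q) : Prop :=
  S.IsSpecification ∧ ∀ q, S.IndependentProgress q

/-- Refinement `S ≤ T` (including the side conditions on the alphabets). -/
def Refines (S : TIOTS Act Q1) (T : TIOTS Act Q2) : Prop :=
  Disjoint S.inputs T.outputs ∧ Disjoint S.outputs T.inputs ∧
  S.inputs ⊆ T.inputs ∧ T.outputs ⊆ S.outputs ∧
  ∃ R : Q1 → Q2 → Prop,
    R S.init T.init ∧
    ∀ s t, R s t →
      (∀ a ∈ T.inputs ∩ S.inputs, ∀ t', T.actTrans t a t' →
        ∃ s', S.actTrans s a s' ∧ R s' t') ∧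
      (∀ a ∈ T.inputs \ S.inputs, ∀ t', T.actTrans t a t' → R s t') ∧
      (∀ a ∈ S.outputs ∩ T.outputs, ∀ s', S.actTrans s a s' →
        ∃ t', T.actTrans t a t' ∧ R s' t') ∧
      (∀ a ∈ S.outputs \ T.outputs, ∀ s', S.actTrans s a s' → R s' t) ∧
      (∀ (d : ℝ≥0) (s' : Q1), S.delayTrans s d s' →
        ∃ t', T.delayTrans t d t' ∧ R s' t')

/-- `Mod S P` : `P` belongs to `mod(S)`, i.e. `P` is an implementation over
the alphabet of `S` satisfying (refining) `S`. -/
def Mod (S : TIOTS Act Q1) (P : TIOTS Act Q2) : Prop :=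
  P.IsImplementation ∧ P.inputs = S.inputs ∧ P.outputs = S.outputs ∧ P.Refines S

/-- The TIOTS obtained from `S` by replacing the initial state by `q`. -/
def withInit (S : TIOTS Act Q) (q : Q) : TIOTS Act Q := { S with init := q }

/-- Reachability by finite sequences of action and delay transitions. -/
inductive Reach (S : TIOTS Act Q) : Q → Q → Prop where
  | refl (q : Q) : Reach S q q
  | act {q q' q'' : Q} (a : Act) : S.actTrans q a q' → Reach S q' q'' → Reach S q q''
  | delay {q q' q'' : Q} (d : ℝ≥0) : S.delayTrans q d q' → Reach S q' q'' → Reach S q q''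

/-- The set of error states relative to a set `X`. -/
def errSet (S : TIOTS Act Q) (X : Set Q) : Set Q :=
  { q | (∃ d : ℝ≥0, ¬ ∃ q', S.delayTrans q d q') ∧
        ∀ (d : ℝ≥0), ∀ o ∈ S.outputs, ∀ q', S.delayTrans q d q' →
          ((¬ ∃ q'', S.actTrans q' o q'') ∨ ∀ q'', S.actTrans q' o q'' → q'' ∈ X) }

/-- The operator `Θ` whose greatest fixpoint is the set of consistent states. -/
def Theta (S : TIOTS Act Q) (X : Set Q) : Set Q :=
  (Set.univ \ S.errSet (Set.univ \ X)) ∩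
  { q | ∀ d : ℝ≥0,
      (∀ q', S.delayTrans q d q' →
        (q' ∈ X ∧ ∀ i ∈ S.inputs, ∃ q'', q'' ∈ X ∧ S.actTrans q' i q'')) ∨
      (∃ d' : ℝ≥0, d' ≤ d ∧ ∃ q' q'', q' ∈ X ∧ q'' ∈ X ∧ ∃ o ∈ S.outputs,
        S.delayTrans q d' q' ∧ S.actTrans q' o q'' ∧
        ∀ i ∈ S.inputs, ∃ q''', q''' ∈ X ∧ S.actTrans q' i q''') }

/-- The set of consistent states: the greatest fixpoint of the monotone
operator `Θ`, given by Knaster–Tarski as the union of all postfixed points. -/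
def consSet (S : TIOTS Act Q) : Set Q := ⋃₀ { X | X ⊆ S.Theta X }

/-- Adversarial pruning `S^Δ`: restrict the states to the consistent ones and
restrict the transition relation accordingly. -/
def prune (S : TIOTS Act Q) (h : S.init ∈ S.consSet) :
    TIOTS Act {q : Q // q ∈ S.consSet} where
  init := ⟨S.init, h⟩
  inputs := S.inputs
  outputs := S.outputs
  actTrans := fun q a q' => S.actTrans q.1 a q'.1
  delayTrans := fun q d q' => S.delayTrans q.1 d q'.1

/-- Conjunction of TIOTSs. -/
def conj (S : TIOTS Act Q1) (T : TIOTS Act Q2) : TIOTS Act (Q1 × Q2) where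
  init := (S.init, T.init)
  inputs := S.inputs ∪ T.inputs
  outputs := S.outputs ∪ T.outputs
  actTrans := fun q a q' =>
    (a ∈ S.acts ∩ T.acts ∧ S.actTrans q.1 a q'.1 ∧ T.actTrans q.2 a q'.2) ∨
    (a ∈ S.acts \ T.acts ∧ S.actTrans q.1 a q'.1 ∧ q'.2 = q.2) ∨
    (a ∈ T.acts \ S.acts ∧ T.actTrans q.2 a q'.2 ∧ q'.1 = q.1)
  delayTrans := fun q d q' => S.delayTrans q.1 d q'.1 ∧ T.delayTrans q.2 d q'.2

/-- Parallel composition of TIOTSs. -/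
def par (S : TIOTS Act Q1) (T : TIOTS Act Q2) : TIOTS Act (Q1 × Q2) where
  init := (S.init, T.init)
  inputs := (S.inputs \ T.outputs) ∪ (T.inputs \ S.outputs)
  outputs := S.outputs ∪ T.outputs
  actTrans := fun q a q' =>
    (a ∈ S.acts ∩ T.acts ∧ S.actTrans q.1 a q'.1 ∧ T.actTrans q.2 a q'.2) ∨
    (a ∈ S.acts \ T.acts ∧ S.actTrans q.1 a q'.1 ∧ q'.2 = q.2) ∨
    (a ∈ T.acts \ S.acts ∧ T.actTrans q.2 a q'.2 ∧ q'.1 = q.1)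
  delayTrans := fun q d q' => S.delayTrans q.1 d q'.1 ∧ T.delayTrans q.2 d q'.2

/-- States of the quotient: pairs of states, a universal state and an error state. -/
inductive QSt (Q1 Q2 : Type) where
  | st : Q1 → Q2 → QSt Q1 Q2
  | univ : QSt Q1 Q2
  | err : QSt Q1 Q2

/-- Action transitions of the quotient `T \\ S`. -/
def quotAct (T : TIOTS Act Q1) (S : TIOTS Act Q2) :
    QSt Q1 Q2 → Act → QSt Q1 Q2 → Prop
  | QSt.st qT qS, a, QSt.st qT' qS' =>
      (a ∈ S.acts ∩ T.acts ∧ T.actTrans qT a qT' ∧ S.actTrans qS a qS') ∨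
      (a ∈ S.acts \ T.acts ∧ S.actTrans qS a qS' ∧ qT' = qT) ∨
      (a ∈ T.acts \ S.acts ∧ T.actTrans qT a qT' ∧ qS' = qS)
  | QSt.st _ qS, a, QSt.univ => a ∈ S.outputs ∧ ¬ ∃ qS', S.actTrans qS a qS'
  | QSt.st qT qS, a, QSt.err =>
      a ∈ S.outputs ∩ T.outputs ∧ (¬ ∃ qT', T.actTrans qT a qT') ∧ ∃ qS', S.actTrans qS a qS'
  | QSt.univ, a, QSt.univ =>
      a ∈ (T.inputs ∪ S.outputs) ∪ ((T.outputs \ S.outputs) ∪ (S.inputs \ T.inputs))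
  | QSt.err, a, QSt.err => a ∈ T.inputs ∪ S.outputs
  | _, _, _ => False

/-- Delay transitions of the quotient `T \\ S`. -/
def quotDelay (T : TIOTS Act Q1) (S : TIOTS Act Q2) :
    QSt Q1 Q2 → ℝ≥0 → QSt Q1 Q2 → Prop
  | QSt.st qT qS, d, QSt.st qT' qS' => T.delayTrans qT d qT' ∧ S.delayTrans qS d qS'
  | QSt.st _ qS, d, QSt.univ => ¬ ∃ qS', S.delayTrans qS d qS'
  | QSt.univ, _, QSt.univ => True
  | _, _, _ => False

/-- The quotient `T \\ S`. -/
def quot (T : TIOTS Act Q1) (S : TIOTS Act Q2) : TIOTS Act (QSt Q1 Q2) where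
  init := QSt.st T.init S.init
  inputs := T.inputs ∪ S.outputs
  outputs := (T.outputs \ S.outputs) ∪ (S.inputs \ T.inputs)
  actTrans := T.quotAct S
  delayTrans := T.quotDelay S

end TIOTS

/-- Clock guards: Boolean formulas over atomic clock constraints `x ≺ n`. -/
inductive ClockGuard (C : Type) where
  | tt : ClockGuard C
  | ff : ClockGuard C
  | lt : C → ℕ → ClockGuard C
  | le : C → ℕ → ClockGuard C
  | gt : C → ℕ → ClockGuard C
  | ge : C → ℕ → ClockGuard C
  | eq : C → ℕ → ClockGuard C
  | and : ClockGuard C → ClockGuard C → ClockGuard C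
  | or : ClockGuard C → ClockGuard C → ClockGuard C
  | not : ClockGuard C → ClockGuard C

namespace ClockGuard

variable {C C' : Type}

/-- Satisfaction of a clock guard by a clock valuation. -/
def sat (v : C → ℝ≥0) : ClockGuard C → Prop
  | tt => True
  | ff => False
  | lt x n => v x < (n : ℝ≥0)
  | le x n => v x ≤ (n : ℝ≥0)
  | gt x n => (n : ℝ≥0) < v x
  | ge x n => (n : ℝ≥0) ≤ v x
  | eq x n => v x = (n : ℝ≥0)
  | and g₁ g₂ => sat v g₁ ∧ sat v g₂
  | or g₁ g₂ => sat v g₁ ∨ sat v g₂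
  | not g => ¬ sat v g

/-- Renaming of the clocks of a guard. -/
def map (f : C → C') : ClockGuard C → ClockGuard C'
  | tt => tt
  | ff => ff
  | lt x n => lt (f x) n
  | le x n => le (f x) n
  | gt x n => gt (f x) n
  | ge x n => ge (f x) n
  | eq x n => eq (f x) n
  | and g₁ g₂ => and (map f g₁) (map f g₂)
  | or g₁ g₂ => or (map f g₁) (map f g₂)
  | not g => not (map f g)

end ClockGuard

/-- A Timed I/O Automaton over action type `Act`, location type `L`
and clock type `C`. -/
structure TIOA (Act L C : Type) where
  init : L
  inputs : Set Act
  outputs : Set Act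
  edges : Set (L × Act × ClockGuard C × Set C × L)
  inv : L → ClockGuard C

namespace TIOA

variable {Act L C L1 L2 C1 C2 : Type}

/-- The alphabet (action set) of a TIOA. -/
def acts (A : TIOA Act L C) : Set Act := A.inputs ∪ A.outputs

open Classical in
/-- Reset the clocks in `c` to zero. -/
noncomputable def resetVal (v : C → ℝ≥0) (c : Set C) : C → ℝ≥0 :=
  fun x => if x ∈ c then 0 else v x

/-- The semantics of a TIOA as a TIOTS. -/
noncomputable def sem (A : TIOA Act L C) : TIOTS Act (L × (C → ℝ≥0)) where
  init := (A.init, fun _ => 0)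
  inputs := A.inputs
  outputs := A.outputs
  actTrans := fun q a q' =>
    ∃ g c, (q.1, a, g, c, q'.1) ∈ A.edges ∧ ClockGuard.sat q.2 g ∧
      q'.2 = resetVal q.2 c ∧ ClockGuard.sat q'.2 (A.inv q'.1)
  delayTrans := fun q d q' =>
    q'.1 = q.1 ∧ q'.2 = (fun x => q.2 x + d) ∧
    ClockGuard.sat q'.2 (A.inv q.1) ∧
    ∀ d' : ℝ≥0, d' < d → ClockGuard.sat (fun x => q.2 x + d') (A.inv q.1)

/-- Conjunction of TIOAs (with disjoint clock sets, realized as a sum type). -/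
def conjA (A : TIOA Act L1 C1) (B : TIOA Act L2 C2) :
    TIOA Act (L1 × L2) (C1 ⊕ C2) where
  init := (A.init, B.init)
  inputs := A.inputs ∪ B.inputs
  outputs := A.outputs ∪ B.outputs
  edges := { e |
    (∃ l1 l2 a g1 g2 c1 c2 l1' l2',
      e = ((l1, l2), a,
            ClockGuard.and (ClockGuard.map Sum.inl g1) (ClockGuard.map Sum.inr g2),
            Sum.inl '' c1 ∪ Sum.inr '' c2, (l1', l2')) ∧
      a ∈ A.acts ∩ B.acts ∧ (l1, a, g1, c1, l1') ∈ A.edges ∧ (l2, a, g2, c2, l2') ∈ B.edges) ∨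
    (∃ l1 l2 a g1 c1 l1',
      e = ((l1, l2), a, ClockGuard.map Sum.inl g1, Sum.inl '' c1, (l1', l2)) ∧
      a ∈ A.acts \ B.acts ∧ (l1, a, g1, c1, l1') ∈ A.edges) ∨
    (∃ l1 l2 a g2 c2 l2',
      e = ((l1, l2), a, ClockGuard.map Sum.inr g2, Sum.inr '' c2, (l1, l2')) ∧
      a ∈ B.acts \ A.acts ∧ (l2, a, g2, c2, l2') ∈ B.edges) }
  inv := fun l =>
    ClockGuard.and (ClockGuard.map Sum.inl (A.inv l.1)) (ClockGuard.map Sum.inr (B.inv l.2))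

/-- Parallel composition of TIOAs (with disjoint clock sets). -/
def parA (A : TIOA Act L1 C1) (B : TIOA Act L2 C2) :
    TIOA Act (L1 × L2) (C1 ⊕ C2) where
  init := (A.init, B.init)
  inputs := (A.inputs \ B.outputs) ∪ (B.inputs \ A.outputs)
  outputs := A.outputs ∪ B.outputs
  edges := { e |
    (∃ l1 l2 a g1 g2 c1 c2 l1' l2',
      e = ((l1, l2), a,
            ClockGuard.and (ClockGuard.map Sum.inl g1) (ClockGuard.map Sum.inr g2),
            Sum.inl '' c1 ∪ Sum.inr '' c2, (l1', l2')) ∧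
      a ∈ A.acts ∩ B.acts ∧ (l1, a, g1, c1, l1') ∈ A.edges ∧ (l2, a, g2, c2, l2') ∈ B.edges) ∨
    (∃ l1 l2 a g1 c1 l1',
      e = ((l1, l2), a, ClockGuard.map Sum.inl g1, Sum.inl '' c1, (l1', l2)) ∧
      a ∈ A.acts \ B.acts ∧ (l1, a, g1, c1, l1') ∈ A.edges) ∨
    (∃ l1 l2 a g2 c2 l2',
      e = ((l1, l2), a, ClockGuard.map Sum.inr g2, Sum.inr '' c2, (l1, l2')) ∧
      a ∈ B.acts \ A.acts ∧ (l2, a, g2, c2, l2') ∈ B.edges) }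
  inv := fun l =>
    ClockGuard.and (ClockGuard.map Sum.inl (A.inv l.1)) (ClockGuard.map Sum.inr (B.inv l.2))

/-- The canonical bijection between the states of `⟦A¹ ∧ A²⟧` (resp. `⟦A¹ ∥ A²⟧`)
and the states of `⟦A¹⟧ ∧ ⟦A²⟧` (resp. `⟦A¹⟧ ∥ ⟦A²⟧`):
`((l¹,l²), v) ↦ ((l¹, v∘inl), (l², v∘inr))`. -/
def stateMap {L1 L2 C1 C2 : Type} (q : (L1 × L2) × ((C1 ⊕ C2) → ℝ≥0)) :
    (L1 × (C1 → ℝ≥0)) × (L2 × (C2 → ℝ≥0)) :=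
  ((q.1.1, fun x => q.2 (Sum.inl x)), (q.1.2, fun x => q.2 (Sum.inr x)))

end TIOA

theorem TIOTS.mem_Theta_transfer {Act Q1 Q2 : Type} (f : Q1 → Q2) (hf : Function.Surjective f)
    (S : TIOTS Act Q1) (T : TIOTS Act Q2) (hi : S.inputs = T.inputs) (ho : S.outputs = T.outputs)
    (hd : ∀ q d q', S.delayTrans q d q' ↔ T.delayTrans (f q) d (f q')) (X : Set Q2)
    (ha : ∀ q a q', f q' ∈ X → (S.actTrans q a q' ↔ T.actTrans (f q) a (f q'))) (q : Q1) :
    q ∈ S.Theta (f ⁻¹' X) ↔ f q ∈ T.Theta X := by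
  have e1 : ∀ q a, (∃ q', f q' ∈ X ∧ S.actTrans q a q') ↔
      (∃ q', f q' ∈ X ∧ T.actTrans (f q) a (f q')) := by
    intro q a
    exact exists_congr fun q' => and_congr_right fun h => ha q a q' h
  have key : ∀ {Q : Type} (U : TIOTS Act Q) (Y : Set Q) (q' : Q) (o : Act),
      ((¬ ∃ q'', U.actTrans q' o q'') ∨ ∀ q'', U.actTrans q' o q'' → q'' ∈ Set.univ \ Y) ↔
      ¬ ∃ q'', q'' ∈ Y ∧ U.actTrans q' o q'' := by
    intro Q U Y q' o
    constructor
    · rintro (h | h) ⟨q'', h1, h2⟩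
      · exact h ⟨q'', h2⟩
      · exact (h q'' h2).2 h1
    · intro h
      exact Or.inr fun q'' h2 => ⟨trivial, fun h1 => h ⟨q'', h1, h2⟩⟩
  have e2 : q ∈ S.errSet (Set.univ \ f ⁻¹' X) ↔ f q ∈ T.errSet (Set.univ \ X) := by
    simp only [TIOTS.errSet, Set.mem_ofPred_eq, key]
    simp only [hf.exists, hf.forall, hd, ho, Set.mem_preimage, e1]
  have e3 : ∀ d', (∃ q' q'', f q' ∈ X ∧ f q'' ∈ X ∧ ∃ o ∈ T.outputs,
        T.delayTrans (f q) d' (f q') ∧ S.actTrans q' o q'' ∧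
        ∀ i ∈ T.inputs, ∃ q''', f q''' ∈ X ∧ T.actTrans (f q') i (f q''')) ↔
      (∃ q' q'', f q' ∈ X ∧ f q'' ∈ X ∧ ∃ o ∈ T.outputs,
        T.delayTrans (f q) d' (f q') ∧ T.actTrans (f q') o (f q'') ∧
        ∀ i ∈ T.inputs, ∃ q''', f q''' ∈ X ∧ T.actTrans (f q') i (f q''')) := by
    intro d'
    refine exists_congr fun q' => exists_congr fun q'' => and_congr_right fun _ =>
      and_congr_right fun h => ?_
    simp only [ha q' _ q'' h]
  unfold TIOTS.Theta
  simp only [Set.mem_inter_iff, Set.mem_sdiff, Set.mem_univ, true_and, e2, Set.mem_ofPred_eq]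
  simp only [hf.exists, hf.forall, hd, ho, hi, Set.mem_preimage, e1, e3]

theorem TIOTS.exists_delay_of_mem_Theta {Act Q : Type} (S : TIOTS Act Q) (X : Set Q) (q : Q)
    (h : q ∈ S.Theta X) : ∃ d q', S.delayTrans q d q' := by
  by_contra hn
  push Not at hn
  exact h.1.2 ⟨⟨0, fun ⟨q', h'⟩ => hn 0 q' h'⟩, fun d o _ q' h' => absurd h' (hn d q')⟩

theorem TIOTS.mem_consSet_transfer {Act Q1 Q2 : Type} (f : Q1 → Q2) (hf : Function.Bijective f)
    (S : TIOTS Act Q1) (T : TIOTS Act Q2) (hi : S.inputs = T.inputs) (ho : S.outputs = T.outputs)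
    (hd : ∀ q d q', S.delayTrans q d q' ↔ T.delayTrans (f q) d (f q'))
    (ha : ∀ q a q', (∃ d q'', S.delayTrans q' d q'') →
      (S.actTrans q a q' ↔ T.actTrans (f q) a (f q'))) (q : Q1) :
    q ∈ S.consSet ↔ f q ∈ T.consSet := by
  constructor
  · rintro ⟨X, hX, hq⟩
    refine ⟨f '' X, ?_, q, hq, rfl⟩
    rintro _ ⟨p, hp, rfl⟩
    have := TIOTS.mem_Theta_transfer f hf.2 S T hi ho hd (f '' X) (fun q a q' h => ?_) p
    · rw [Set.preimage_image_eq X hf.1] at this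
      exact this.1 (hX hp)
    · obtain ⟨p', hp', e⟩ := h
      obtain rfl := hf.1 e
      exact ha q a p' (S.exists_delay_of_mem_Theta X p' (hX hp'))
  · rintro ⟨X, hX, hq⟩
    refine ⟨f ⁻¹' X, ?_, hq⟩
    intro p hp
    refine (TIOTS.mem_Theta_transfer f hf.2 S T hi ho hd X (fun q a q' h => ?_) p).2 (hX hp)
    obtain ⟨d, q'', h'⟩ := T.exists_delay_of_mem_Theta X _ (hX h)
    obtain ⟨q'', rfl⟩ := hf.2 q''
    exact ha q a q' ⟨d, q'', (hd _ _ _).2 h'⟩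

theorem TIOTS.exists_delay_of_mem_consSet {Act Q : Type} (S : TIOTS Act Q) (q : Q)
    (h : q ∈ S.consSet) : ∃ d q', S.delayTrans q d q' := by
  obtain ⟨X, hX, hq⟩ := h
  exact S.exists_delay_of_mem_Theta X q (hX hq)

theorem ClockGuard.sat_map {C C' : Type} (f : C → C') (v : C' → ℝ≥0) (g : ClockGuard C) :
    ClockGuard.sat v (ClockGuard.map f g) ↔ ClockGuard.sat (fun x => v (f x)) g := by
  induction g <;> simp_all [ClockGuard.sat, ClockGuard.map]

theorem TIOA.stateMap_bijective {L1 L2 C1 C2 : Type} :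
    Function.Bijective (TIOA.stateMap (L1 := L1) (L2 := L2) (C1 := C1) (C2 := C2)) := by
  constructor
  · rintro ⟨⟨l1, l2⟩, v⟩ ⟨⟨m1, m2⟩, w⟩ h
    simp only [TIOA.stateMap, Prod.mk.injEq] at h
    obtain ⟨⟨rfl, h1⟩, rfl, h2⟩ := h
    congr 1
    funext x
    cases x with
    | inl x => exact congrFun h1 x
    | inr x => exact congrFun h2 x
  · rintro ⟨⟨l1, v1⟩, l2, v2⟩
    exact ⟨((l1, l2), Sum.elim v1 v2), rfl⟩

theorem TIOA.delay_iff {Act L1 L2 C1 C2 : Type} (A : TIOA Act L1 C1) (B : TIOA Act L2 C2)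
    (q : (L1 × L2) × ((C1 ⊕ C2) → ℝ≥0)) (d : ℝ≥0) (q' : (L1 × L2) × ((C1 ⊕ C2) → ℝ≥0)) :
    (A.parA B).sem.delayTrans q d q' ↔
      (A.sem.par B.sem).delayTrans (TIOA.stateMap q) d (TIOA.stateMap q') := by
  obtain ⟨⟨l1, l2⟩, v⟩ := q
  obtain ⟨⟨m1, m2⟩, w⟩ := q'
  simp only [TIOA.sem, TIOA.parA, TIOTS.par, TIOA.stateMap, ClockGuard.sat, ClockGuard.sat_map,
    Prod.mk.injEq, funext_iff, Sum.forall]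
  grind

theorem TIOA.inv_of_delay {Act L C : Type} (A : TIOA Act L C) (q : L × (C → ℝ≥0))
    (h : ∃ d q', A.sem.delayTrans q d q') : ClockGuard.sat q.2 (A.inv q.1) := by
  obtain ⟨d, q', -, h2, h3, h4⟩ := h
  rcases eq_or_ne d 0 with rfl | hd
  · rw [h2] at h3
    simpa using h3
  · simpa using h4 0 (pos_iff_ne_zero.2 hd)

theorem TIOA.resetVal_congr {C D : Type} {v : C → ℝ≥0} {w : D → ℝ≥0} {c : Set C} {e : Set D}
    {x : C} {y : D} (h : x ∈ c ↔ y ∈ e) (hv : v x = w y) :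
    TIOA.resetVal v c x = TIOA.resetVal w e y := by
  unfold TIOA.resetVal
  by_cases hx : x ∈ c
  · rw [if_pos hx, if_pos (h.1 hx)]
  · rw [if_neg hx, if_neg (fun hy => hx (h.2 hy)), hv]

theorem TIOA.resetVal_of_not_mem {C : Type} {v : C → ℝ≥0} {c : Set C}
    {x : C} (h : x ∉ c) : TIOA.resetVal v c x = v x := if_neg h

theorem TIOA.act_iff {Act L1 L2 C1 C2 : Type} (A : TIOA Act L1 C1) (B : TIOA Act L2 C2)
    (q : (L1 × L2) × ((C1 ⊕ C2) → ℝ≥0)) (a : Act) (q' : (L1 × L2) × ((C1 ⊕ C2) → ℝ≥0))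
    (h : ∃ d q'', (A.parA B).sem.delayTrans q' d q'') :
    (A.parA B).sem.actTrans q a q' ↔
      (A.sem.par B.sem).actTrans (TIOA.stateMap q) a (TIOA.stateMap q') := by
  have hinv := TIOA.inv_of_delay _ _ h
  clear h
  obtain ⟨⟨l1, l2⟩, v⟩ := q
  obtain ⟨⟨m1, m2⟩, w⟩ := q'
  have hi := hinv
  simp only [TIOA.parA, ClockGuard.sat, ClockGuard.sat_map] at hi
  obtain ⟨i1, i2⟩ := hi
  constructor
  · rintro ⟨g, c, he, hg, hw, -⟩
    dsimp only at he hg hw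
    subst hw
    rcases he with ⟨_, _, _, g1, g2, c1, c2, _, _, e, hact, h1, h2⟩ |
      ⟨_, _, _, g1, c1, _, e, hact, h1⟩ | ⟨_, _, _, g2, c2, _, e, hact, h2⟩
    · simp only [Prod.mk.injEq] at e
      obtain ⟨⟨rfl, rfl⟩, rfl, rfl, rfl, rfl, rfl⟩ := e
      simp only [ClockGuard.sat, ClockGuard.sat_map] at hg
      refine Or.inl ⟨hact, ⟨g1, c1, h1, hg.1, ?_, i1⟩, ⟨g2, c2, h2, hg.2, ?_, i2⟩⟩
      · funext x; exact TIOA.resetVal_congr (by simp) rfl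
      · funext x; exact TIOA.resetVal_congr (by simp) rfl
    · simp only [Prod.mk.injEq] at e
      obtain ⟨⟨rfl, rfl⟩, rfl, rfl, rfl, rfl, rfl⟩ := e
      simp only [ClockGuard.sat_map] at hg
      refine Or.inr (Or.inl ⟨hact, ⟨g1, c1, h1, hg, ?_, i1⟩, Prod.ext rfl ?_⟩)
      · funext x; exact TIOA.resetVal_congr (by simp) rfl
      · funext x; exact TIOA.resetVal_of_not_mem (by simp)
    · simp only [Prod.mk.injEq] at e
      obtain ⟨⟨rfl, rfl⟩, rfl, rfl, rfl, rfl, rfl⟩ := e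
      simp only [ClockGuard.sat_map] at hg
      refine Or.inr (Or.inr ⟨hact, ⟨g2, c2, h2, hg, ?_, i2⟩, Prod.ext rfl ?_⟩)
      · funext x; exact TIOA.resetVal_congr (by simp) rfl
      · funext x; exact TIOA.resetVal_of_not_mem (by simp)
  · rintro (⟨hact, ⟨g1, c1, h1, s1, r1, -⟩, ⟨g2, c2, h2, s2, r2, -⟩⟩ |
      ⟨hact, ⟨g1, c1, h1, s1, r1, -⟩, r2⟩ | ⟨hact, ⟨g2, c2, h2, s2, r2, -⟩, r1⟩)
    · refine ⟨_, _, Or.inl ⟨l1, l2, a, g1, g2, c1, c2, m1, m2, rfl, hact, h1, h2⟩, ?_, ?_, hinv⟩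
      · simpa only [ClockGuard.sat, ClockGuard.sat_map] using ⟨s1, s2⟩
      · funext x
        cases x with
        | inl x => exact (congrFun r1 x).trans (TIOA.resetVal_congr (by simp) rfl)
        | inr x => exact (congrFun r2 x).trans (TIOA.resetVal_congr (by simp) rfl)
    · simp only [TIOA.stateMap, Prod.mk.injEq] at r2
      obtain ⟨rfl, r2⟩ := r2
      refine ⟨_, _, Or.inr (Or.inl ⟨l1, m2, a, g1, c1, m1, rfl, hact, h1⟩), ?_, ?_, hinv⟩
      · exact (ClockGuard.sat_map _ _ _).2 s1
      · funext x
        cases x with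
        | inl x => exact (congrFun r1 x).trans (TIOA.resetVal_congr (by simp) rfl)
        | inr x => exact (congrFun r2 x).trans (TIOA.resetVal_of_not_mem (by simp)).symm
    · simp only [TIOA.stateMap, Prod.mk.injEq] at r1
      obtain ⟨rfl, r1⟩ := r1
      refine ⟨_, _, Or.inr (Or.inr ⟨m1, l2, a, g2, c2, m2, rfl, hact, h2⟩), ?_, ?_, hinv⟩
      · exact (ClockGuard.sat_map _ _ _).2 s2
      · funext x
        cases x with
        | inl x => exact (congrFun r1 x).trans (TIOA.resetVal_of_not_mem (by simp)).symm
        | inr x => exact (congrFun r2 x).trans (TIOA.resetVal_congr (by simp) rfl)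

/-- Parallel composition commutes with semantics up to
adversarial pruning: `(⟦A¹ ∥ A²⟧)^Δ = (⟦A¹⟧ ∥ ⟦A²⟧)^Δ` (identifying states
via the canonical bijection `stateMap`): same states (consistent-state sets),
same initial state, same action sets with the same partition, and same
(restricted) transition relation. -/
theorem parA_sem_prune_eq {Act L1 L2 C1 C2 : Type}
    (A : TIOA Act L1 C1) (B : TIOA Act L2 C2)
    (hcomp : Disjoint A.outputs B.outputs) :
    (∀ q : (L1 × L2) × ((C1 ⊕ C2) → ℝ≥0),
        q ∈ ((A.parA B).sem).consSet ↔
          TIOA.stateMap q ∈ ((A.sem).par (B.sem)).consSet) ∧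
    TIOA.stateMap ((A.parA B).sem).init = ((A.sem).par (B.sem)).init ∧
    ((A.parA B).sem).inputs = ((A.sem).par (B.sem)).inputs ∧
    ((A.parA B).sem).outputs = ((A.sem).par (B.sem)).outputs ∧
    (∀ (q : (L1 × L2) × ((C1 ⊕ C2) → ℝ≥0)) (a : Act)
        (q' : (L1 × L2) × ((C1 ⊕ C2) → ℝ≥0)),
      (((A.parA B).sem).actTrans q a q' ∧
          q ∈ ((A.parA B).sem).consSet ∧ q' ∈ ((A.parA B).sem).consSet) ↔
      (((A.sem).par (B.sem)).actTrans (TIOA.stateMap q) a (TIOA.stateMap q') ∧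
          TIOA.stateMap q ∈ ((A.sem).par (B.sem)).consSet ∧
          TIOA.stateMap q' ∈ ((A.sem).par (B.sem)).consSet)) ∧
    (∀ (q : (L1 × L2) × ((C1 ⊕ C2) → ℝ≥0)) (d : ℝ≥0)
        (q' : (L1 × L2) × ((C1 ⊕ C2) → ℝ≥0)),
      (((A.parA B).sem).delayTrans q d q' ∧
          q ∈ ((A.parA B).sem).consSet ∧ q' ∈ ((A.parA B).sem).consSet) ↔
      (((A.sem).par (B.sem)).delayTrans (TIOA.stateMap q) d (TIOA.stateMap q') ∧
          TIOA.stateMap q ∈ ((A.sem).par (B.sem)).consSet ∧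
          TIOA.stateMap q' ∈ ((A.sem).par (B.sem)).consSet)) := by
  have hc : ∀ q : (L1 × L2) × ((C1 ⊕ C2) → ℝ≥0), q ∈ ((A.parA B).sem).consSet ↔
      TIOA.stateMap q ∈ ((A.sem).par (B.sem)).consSet :=
    TIOTS.mem_consSet_transfer TIOA.stateMap TIOA.stateMap_bijective _ _ rfl rfl
      (TIOA.delay_iff A B) (TIOA.act_iff A B)
  refine ⟨hc, rfl, rfl, rfl, fun q a q' => ?_, fun q d q' => ?_⟩
  · rw [← hc q, ← hc q']
    exact and_congr_left fun h =>
      TIOA.act_iff A B q a q' (TIOTS.exists_delay_of_mem_consSet _ _ h.2)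
  · rw [← hc q, ← hc q', TIOA.delay_iff A B]
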